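/- Let p : (Y, ν, S₁, S₂) → (X, μ, T₁, T₂) be a factor map between systems, and assume (X, μ, T₁, T₂) is magic. Then for every bounded measurable function f on X, the box average with respect to (S₁, S₂) of the function f∘p − E_ν(f∘p | ℐ(S₁) ∨ ℐ(S₂)) equals 0. -/

import Mathlib

open MeasureTheory Filter

/-- The σ-algebra `ℐ(T)` of `T`-invariant measurable sets. -/
def invSigma {X : Type*} [m : MeasurableSpace X] (T : X → X) : MeasurableSpace X where
  MeasurableSet' s := MeasurableSet s ∧ T ⁻¹' s = s
  measurableSet_empty := ⟨MeasurableSet.empty, rfl⟩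
  measurableSet_compl s hs := ⟨hs.1.compl, by rw [Set.preimage_compl, hs.2]⟩
  measurableSet_iUnion f hf :=
    ⟨MeasurableSet.iUnion fun i => (hf i).1, by
      rw [Set.preimage_iUnion]
      exact Set.iUnion_congr fun i => (hf i).2⟩

/-- The box average of `f` with respect to `(T₁, T₂)` equals `L`: for every
`n₂` the inner Cesàro limit `c n₂` exists, and the Cesàro averages of `c`
converge to `L`. -/
def HasBoxAvg {X : Type*} [MeasurableSpace X] (μ : Measure X)
    (T₁ T₂ : X → X) (f : X → ℝ) (L : ℝ) : Prop :=
  ∃ c : ℕ → ℝ,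
    (∀ n₂ : ℕ, Tendsto (fun N₁ : ℕ =>
        (∑ n₁ ∈ Finset.range N₁,
          ∫ x, f x * f (T₁^[n₁] x) * f (T₂^[n₂] x) * f (T₁^[n₁] (T₂^[n₂] x)) ∂μ)
          / (N₁ : ℝ))
      atTop (nhds (c n₂))) ∧
    Tendsto (fun N₂ : ℕ => (∑ n₂ ∈ Finset.range N₂, c n₂) / (N₂ : ℝ))
      atTop (nhds L)

/-- A system is magic if every bounded measurable function whose conditional
expectation on `ℐ(T₁) ∨ ℐ(T₂)` vanishes has box average `0`. -/
def IsMagic {X : Type*} [MeasurableSpace X] (μ : Measure X) (T₁ T₂ : X ≃ᵐ X) : Prop :=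
  ∀ f : X → ℝ, Measurable f → (∃ C : ℝ, ∀ x, |f x| ≤ C) →
    (μ[f | invSigma ⇑T₁ ⊔ invSigma ⇑T₂] =ᵐ[μ] 0) →
    HasBoxAvg μ ⇑T₁ ⇑T₂ f 0

/-- Pairing with an invariant vector is controlled by the averaged autocorrelations. -/
theorem exists_tendsto_average_inner_and_sq_inner_le {E : Type*} [NormedAddCommGroup E]
    [InnerProductSpace ℝ E] [CompleteSpace E] (U : E →ₗᵢ[ℝ] E) (v w : E) (hw : U w = w)
    (hw₁ : ‖w‖ ≤ 1) :
    ∃ L : ℝ, Tendsto (fun N : ℕ => (∑ n ∈ Finset.range N, inner ℝ v (U^[n] v)) / (N : ℝ))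
      atTop (nhds L) ∧ (inner ℝ v w) ^ 2 ≤ L := by
  set F := (U.toContinuousLinearMap).eqLocus (1 : E →L[ℝ] E) with hF
  set P := F.orthogonalProjectionOnto v with hP
  have hwF : w ∈ F := by simpa [hF] using hw
  refine ⟨inner ℝ v (P : E), ?_, ?_⟩
  · have h := ContinuousLinearMap.tendsto_birkhoffAverage_orthogonalProjection
      U.toContinuousLinearMap U.norm_toContinuousLinearMap_le v
    refine ((tendsto_const_nhds (x := v)).inner h).congr fun N => ?_
    simp [birkhoffAverage, birkhoffSum, inner_smul_right, inner_sum, div_eq_inv_mul]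
  · have h₁ : inner ℝ v w = inner ℝ (P : E) w := by
      have := F.inner_orthogonalProjectionOnto_eq_of_mem_left ⟨w, hwF⟩ v
      rw [real_inner_comm, ← this, real_inner_comm]; rfl
    have h₂ : inner ℝ v (P : E) = ‖(P : E)‖ ^ 2 := by
      have := F.inner_orthogonalProjectionOnto_eq_of_mem_left P v
      rw [real_inner_comm, ← this, ← real_inner_self_eq_norm_sq]; rfl
    rw [h₁, h₂, sq_le_sq, abs_norm]
    exact (abs_real_inner_le_norm _ _).trans (mul_le_of_le_one_right (norm_nonneg _) hw₁)

/-- The integral of a bounded function against an invariant function bounded by one is controlled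
by the averaged autocorrelations. -/
theorem exists_tendsto_average_integral_and_sq_integral_le {Y : Type*} [MeasurableSpace Y]
    {ν : Measure Y} [IsProbabilityMeasure ν] {S : Y → Y} (hS : MeasurePreserving S ν ν)
    {u w : Y → ℝ} (hu : MemLp u 2 ν) (hw : MemLp w 2 ν) (hwS : ∀ y, w (S y) = w y)
    (hw₁ : ∀ y, |w y| ≤ 1) :
    ∃ L : ℝ, Tendsto (fun N : ℕ => (∑ n ∈ Finset.range N, ∫ y, u y * u (S^[n] y) ∂ν) / (N : ℝ))
      atTop (nhds L) ∧ (∫ y, u y * w y ∂ν) ^ 2 ≤ L := by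
  have hinner : ∀ {a b : Y → ℝ} (ha : MemLp a 2 ν) (hb : MemLp b 2 ν),
      inner ℝ (ha.toLp a) (hb.toLp b) = ∫ y, a y * b y ∂ν := by
    intro a b ha hb
    rw [L2.inner_def]
    refine integral_congr_ae ?_
    filter_upwards [ha.coeFn_toLp, hb.coeFn_toLp] with y h₁ h₂
    rw [h₁, h₂]; simp [mul_comm]
  obtain ⟨L, hL, hle⟩ := exists_tendsto_average_inner_and_sq_inner_le
    (Lp.compMeasurePreservingₗᵢ ℝ S hS : Lp ℝ 2 ν →ₗᵢ[ℝ] Lp ℝ 2 ν) (hu.toLp u) (hw.toLp w)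
    (by
      change Lp.compMeasurePreserving S hS _ = _
      rw [Lp.toLp_compMeasurePreserving]
      congr 1
      exact funext hwS)
    (by
      refine (Lp.norm_le_of_ae_bound (C := 1) zero_le_one ?_).trans (by simp [measureUnivNNReal])
      filter_upwards [hw.coeFn_toLp] with y hy
      rw [hy]; exact hw₁ y)
  refine ⟨L, hL.congr fun N => ?_, by rwa [hinner] at hle⟩
  congr 1
  refine Finset.sum_congr rfl fun n _ => ?_
  have : (Lp.compMeasurePreservingₗᵢ ℝ S hS : Lp ℝ 2 ν →ₗᵢ[ℝ] Lp ℝ 2 ν)^[n] (hu.toLp u)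
      = (hu.comp_measurePreserving (hS.iterate n)).toLp _ := by
    change (Lp.compMeasurePreserving S hS)^[n] _ = _
    rw [Lp.compMeasurePreserving_iterate, Lp.toLp_compMeasurePreserving]
  rw [this, hinner]
  rfl

theorem invSigma_le {X : Type*} [m : MeasurableSpace X] (T : X → X) : invSigma T ≤ m :=
  fun _ hs => hs.1

theorem invSigma_sup_le {X : Type*} [m : MeasurableSpace X] (T₁ T₂ : X → X) :
    invSigma T₁ ⊔ invSigma T₂ ≤ m :=
  sup_le (invSigma_le T₁) (invSigma_le T₂)

/-- A bounded function with zero box average is orthogonal to products of a `S₁`-invariant set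
with a `S₂`-invariant one. -/
theorem HasBoxAvg.setIntegral_inter_eq_zero {Y : Type*} [MeasurableSpace Y] {ν : Measure Y}
    [IsProbabilityMeasure ν] {S₁ S₂ : Y → Y} (hS₁ : MeasurePreserving S₁ ν ν)
    (hS₂ : MeasurePreserving S₂ ν ν) (hcomm : Function.Commute S₁ S₂) {F : Y → ℝ}
    (hF : Measurable F) {C : ℝ} (hFC : ∀ y, |F y| ≤ C) (h : HasBoxAvg ν S₁ S₂ F 0)
    {A B : Set Y} (hA : MeasurableSet[invSigma S₁] A) (hB : MeasurableSet[invSigma S₂] B) :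
    ∫ y in A ∩ B, F y ∂ν = 0 := by
  obtain ⟨c, hc, hc₀⟩ := h
  have hAm : MeasurableSet A := hA.1
  have hBm : MeasurableSet B := hB.1
  have hC : 0 ≤ C := (abs_nonneg _).trans (hFC (nonempty_of_isProbabilityMeasure ν).some)
  set a : Y → ℝ := A.indicator 1 with ha
  set b : Y → ℝ := B.indicator 1 with hb
  have inv : ∀ {S : Y → Y} {D : Set Y}, S ⁻¹' D = D → ∀ y,
      D.indicator (1 : Y → ℝ) (S y) = D.indicator 1 y := by
    intro S D hD y
    have : S y ∈ D ↔ y ∈ D := by rw [← Set.mem_preimage, hD]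
    by_cases hy : y ∈ D <;> simp [hy, this]
  have ind : ∀ (D : Set Y) y, |D.indicator (1 : Y → ℝ) y| ≤ 1 := by
    intro D y
    by_cases hy : y ∈ D <;> simp [hy]
  have ham : Measurable a := measurable_one.indicator hAm
  have hbm : Measurable b := measurable_one.indicator hBm
  have memLp : ∀ {g : Y → ℝ} {K : ℝ}, Measurable g → (∀ y, |g y| ≤ K) → MemLp g 2 ν :=
    fun hg hK => .of_bound hg.aestronglyMeasurable _ (Eventually.of_forall hK)
  have hinner : ∀ n, (∫ y, (F y * F (S₂^[n] y)) * (a y * a (S₂^[n] y)) ∂ν) ^ 2 ≤ c n := by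
    intro n
    have hm := (hS₂.iterate n).measurable
    obtain ⟨L, hL, hle⟩ := exists_tendsto_average_integral_and_sq_integral_le hS₁
      (u := fun y => F y * F (S₂^[n] y)) (w := fun y => a y * a (S₂^[n] y))
      (memLp (K := C * C) (by fun_prop) fun y => by
        rw [abs_mul]; exact mul_le_mul (hFC _) (hFC _) (abs_nonneg _) hC)
      (memLp (K := 1 * 1) (by fun_prop) fun y => by
        rw [abs_mul]; exact mul_le_mul (ind _ _) (ind _ _) (abs_nonneg _) zero_le_one)
      (fun y => by
        rw [ha, inv hA.2, ← (hcomm.iterate_right n).eq y, inv hA.2])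
      (fun y => by
        rw [abs_mul]; exact mul_le_one₀ (ind _ _) (abs_nonneg _) (ind _ _))
    refine hle.trans_eq (tendsto_nhds_unique hL ((hc n).congr fun N => ?_))
    congr 1
    refine Finset.sum_congr rfl fun k _ => integral_congr_ae (Eventually.of_forall fun y => ?_)
    have := ((hcomm.iterate_left k).iterate_right n).eq y
    simp only [this]
    ring
  obtain ⟨L, hL, hle⟩ := exists_tendsto_average_integral_and_sq_integral_le hS₂
    (u := fun y => F y * a y) (w := b)
    (memLp (K := C * 1) (by fun_prop) fun y => by
      rw [abs_mul]; exact mul_le_mul (hFC _) (ind _ _) (abs_nonneg _) hC)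
    (memLp hbm (ind B)) (inv hB.2) (ind B)
  have hL₀ : L ^ 2 ≤ 0 := by
    refine le_of_tendsto_of_tendsto' (hL.pow 2) hc₀ fun N => ?_
    have := sum_div_card_sq_le_sum_sq_div_card (s := Finset.range N)
      (f := fun n => ∫ y, (F y * F (S₂^[n] y)) * (a y * a (S₂^[n] y)) ∂ν)
    rw [Finset.card_range] at this
    refine le_trans (le_of_eq ?_) (this.trans ?_)
    · congr 2
      refine Finset.sum_congr rfl fun k _ =>
        integral_congr_ae (Eventually.of_forall fun y => ?_)
      ring
    · gcongr with n _
      exact hinner n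
  have hL₁ : L = 0 := by nlinarith [sq_nonneg L]
  rw [hL₁] at hle
  have h₀ : ∫ y, F y * a y * b y ∂ν = 0 := by
    nlinarith [sq_nonneg (∫ y, F y * a y * b y ∂ν)]
  rw [← h₀, ← integral_indicator (hAm.inter hBm)]
  refine integral_congr_ae (Eventually.of_forall fun y => ?_)
  by_cases h₁ : y ∈ A <;> by_cases h₂ : y ∈ B <;> simp [ha, hb, h₁, h₂]

/-- The supremum of two σ-algebras is generated by intersections. -/
theorem MeasurableSpace.sup_eq_generateFrom_image2_inter {Y : Type*} (m₁ m₂ : MeasurableSpace Y) :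
    m₁ ⊔ m₂ = MeasurableSpace.generateFrom
      (Set.image2 (· ∩ ·) {s | MeasurableSet[m₁] s} {s | MeasurableSet[m₂] s}) := by
  refine le_antisymm (sup_le ?_ ?_) (MeasurableSpace.generateFrom_le ?_)
  · exact fun s hs => MeasurableSpace.measurableSet_generateFrom
      ⟨s, hs, Set.univ, @MeasurableSet.univ _ m₂, by simp⟩
  · exact fun s hs => MeasurableSpace.measurableSet_generateFrom
      ⟨Set.univ, @MeasurableSet.univ _ m₁, s, hs, by simp⟩
  · rintro _ ⟨s, hs, t, ht, rfl⟩
    exact @MeasurableSet.inter _ (m₁ ⊔ m₂) _ _ ((le_sup_left : m₁ ≤ m₁ ⊔ m₂) s hs)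
      ((le_sup_right : m₂ ≤ m₁ ⊔ m₂) t ht)

/-- A function whose integrals over intersections of measurable sets of `m₁` and `m₂` vanish has
zero conditional expectation on `m₁ ⊔ m₂`. -/
theorem condExp_sup_eq_zero_of_setIntegral_inter {Y : Type*} [m : MeasurableSpace Y]
    {ν : Measure Y} [IsFiniteMeasure ν] {m₁ m₂ : MeasurableSpace Y} (hm : m₁ ⊔ m₂ ≤ m)
    {F : Y → ℝ} (hF : Integrable F ν)
    (h : ∀ A B, MeasurableSet[m₁] A → MeasurableSet[m₂] B → ∫ y in A ∩ B, F y ∂ν = 0) :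
    ν[F | m₁ ⊔ m₂] =ᵐ[ν] 0 := by
  have key : ∀ s, MeasurableSet[m₁ ⊔ m₂] s → ∫ y in s, F y ∂ν = 0 := by
    refine MeasurableSpace.induction_on_inter
      (MeasurableSpace.sup_eq_generateFrom_image2_inter m₁ m₂) ?_ (by simp) ?_ ?_ ?_
    · rintro _ ⟨s, hs, t, ht, rfl⟩ _ ⟨s', hs', t', ht', rfl⟩ -
      exact ⟨s ∩ s', @MeasurableSet.inter _ m₁ _ _ hs hs', t ∩ t',
        @MeasurableSet.inter _ m₂ _ _ ht ht', Set.inter_inter_inter_comm _ _ _ _⟩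
    · rintro _ ⟨s, hs, t, ht, rfl⟩
      exact h s t hs ht
    · intro t ht h₀
      have h₁ := h Set.univ Set.univ (@MeasurableSet.univ _ m₁) (@MeasurableSet.univ _ m₂)
      have h₂ := integral_add_compl (hm t ht) hF
      simp only [Set.univ_inter, setIntegral_univ] at h₁
      linarith
    · intro f hd hfm h₀
      rw [integral_iUnion (fun i => hm _ (hfm i)) hd hF.integrableOn]
      simp [h₀]
  refine (ae_eq_condExp_of_forall_setIntegral_eq hm hF (fun _ _ _ => integrableOn_zero)
    (fun s hs _ => ?_) aestronglyMeasurable_zero).symm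
  simp [key s hs]

theorem HasBoxAvg.congr_ae {Y : Type*} [MeasurableSpace Y] {ν : Measure Y} {S₁ S₂ : Y → Y}
    (hS₁ : MeasurePreserving S₁ ν ν) (hS₂ : MeasurePreserving S₂ ν ν) {F G : Y → ℝ} {L : ℝ}
    (hFG : F =ᵐ[ν] G) (h : HasBoxAvg ν S₁ S₂ F L) : HasBoxAvg ν S₁ S₂ G L := by
  obtain ⟨c, hc, hcL⟩ := h
  refine ⟨c, fun n => (hc n).congr fun N => ?_, hcL⟩
  congr 1
  refine Finset.sum_congr rfl fun k _ => integral_congr_ae ?_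
  have h₁ := (hS₁.iterate k).quasiMeasurePreserving.ae hFG
  have h₂ := (hS₂.iterate n).quasiMeasurePreserving.ae hFG
  have h₃ := ((hS₁.iterate k).comp (hS₂.iterate n)).quasiMeasurePreserving.ae hFG
  filter_upwards [hFG, h₁, h₂, h₃] with y e₀ e₁ e₂ e₃
  simp only [Function.comp_apply] at e₃
  rw [e₀, e₁, e₂, e₃]

theorem ae_semiconj_iterate {X Y : Type*} [MeasurableSpace Y] {ν : Measure Y} {S : Y → Y}
    (hS : MeasurePreserving S ν ν) {T : X → X} {p : Y → X} (h : ∀ᵐ y ∂ν, p (S y) = T (p y))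
    (n : ℕ) : ∀ᵐ y ∂ν, p (S^[n] y) = T^[n] (p y) := by
  induction n with
  | zero => simp
  | succ n ih =>
    filter_upwards [h, hS.quasiMeasurePreserving.ae ih] with y h₁ h₂
    rw [Function.iterate_succ_apply, h₂, h₁, Function.iterate_succ_apply]

theorem HasBoxAvg.comp_factor {X Y : Type*} [MeasurableSpace X] [MeasurableSpace Y]
    {ν : Measure Y} {S₁ S₂ : Y → Y} (hS₁ : MeasurePreserving S₁ ν ν)
    (hS₂ : MeasurePreserving S₂ ν ν) {T₁ T₂ : X → X} (hT₁ : Measurable T₁) (hT₂ : Measurable T₂)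
    {p : Y → X} (hp : Measurable p)
    (hp₁ : ∀ᵐ y ∂ν, p (S₁ y) = T₁ (p y)) (hp₂ : ∀ᵐ y ∂ν, p (S₂ y) = T₂ (p y))
    {h : X → ℝ} (hh : Measurable h) {L : ℝ} (hL : HasBoxAvg (ν.map p) T₁ T₂ h L) :
    HasBoxAvg ν S₁ S₂ (fun y => h (p y)) L := by
  obtain ⟨c, hc, hcL⟩ := hL
  refine ⟨c, fun n => (hc n).congr fun N => ?_, hcL⟩
  congr 1
  refine Finset.sum_congr rfl fun k _ => ?_
  have hk := hT₁.iterate k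
  have hn := hT₂.iterate n
  rw [integral_map hp.aemeasurable (by fun_prop)]
  refine integral_congr_ae ?_
  have h₁ := ae_semiconj_iterate hS₁ hp₁ k
  have h₂ := ae_semiconj_iterate hS₂ hp₂ n
  filter_upwards [h₁, h₂, (hS₂.iterate n).quasiMeasurePreserving.ae h₁] with y e₁ e₂ e₃
  rw [e₃, e₁, e₂]

/-- The preimage of an invariant set under a factor map is almost everywhere equal to an invariant
set. -/
theorem invSigma_le_map_eventuallyMeasurableSpace {X Y : Type*} [MeasurableSpace X]
    [MeasurableSpace Y] {ν : Measure Y} {S : Y → Y} (hS : MeasurePreserving S ν ν) {T : X → X}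
    {p : Y → X} (hp : Measurable p) (hpS : ∀ᵐ y ∂ν, p (S y) = T (p y)) :
    invSigma T ≤ (eventuallyMeasurableSpace (invSigma S) (ae ν)).map p := by
  rintro A ⟨hA, hAT⟩
  obtain ⟨t, ht, hte, htS⟩ :=
    hS.quasiMeasurePreserving.exists_preimage_eq_of_preimage_ae (s := p ⁻¹' A)
      (hp hA).nullMeasurableSet (by
        filter_upwards [hpS] with y hy
        refine propext ?_
        change p (S y) ∈ A ↔ p y ∈ A
        rw [hy, ← Set.mem_preimage, hAT])
  exact ⟨t, ⟨ht, htS⟩, hte.symm⟩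

theorem aestronglyMeasurable_comp_of_le_map_eventuallyMeasurableSpace {X Y : Type*}
    {mX : MeasurableSpace X} {mY : MeasurableSpace Y} [MeasurableSpace Y] {ν : Measure Y}
    {p : Y → X} (hp : mX ≤ (eventuallyMeasurableSpace mY (ae ν)).map p) {k : X → ℝ}
    (hk : StronglyMeasurable[mX] k) : AEStronglyMeasurable[mY] (fun y => k (p y)) ν := by
  have happrox : ∀ n, AEStronglyMeasurable[mY] (fun y => hk.approx n (p y)) ν := by
    intro n
    induction hk.approx n using SimpleFunc.induction with
    | @const c s hs =>
      obtain ⟨t, ht, hte⟩ := hp s hs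
      refine ⟨t.indicator fun _ => c, stronglyMeasurable_const.indicator ht, ?_⟩
      filter_upwards [indicator_ae_eq_of_ae_eq_set (f := fun _ => c) hte] with y hy
      rw [← hy]
      by_cases h : p y ∈ s <;> simp [h]
    | add _ hf hg => exact hf.add hg
  choose g hgm hg using happrox
  refine ⟨fun y => limsup (fun n => g n y) atTop,
    (Measurable.limsup fun n => (hgm n).measurable).stronglyMeasurable, ?_⟩
  filter_upwards [ae_all_iff.2 hg] with y hy
  have hlim := hk.tendsto_approx (p y)
  simp only [hy] at hlim
  exact hlim.limsup_eq.symm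

theorem box_seminorm_zero_of_magic_factor
    {Y : Type*} [MeasurableSpace Y] (ν : Measure Y) [IsProbabilityMeasure ν]
    (S₁ S₂ : Y ≃ᵐ Y)
    (hS₁ : MeasurePreserving S₁ ν ν) (hS₂ : MeasurePreserving S₂ ν ν)
    (hScomm : ∀ y, S₁ (S₂ y) = S₂ (S₁ y))
    {X : Type*} [MeasurableSpace X] (μ : Measure X) [IsProbabilityMeasure μ]
    (T₁ T₂ : X ≃ᵐ X)
    (hT₁ : MeasurePreserving T₁ μ μ) (hT₂ : MeasurePreserving T₂ μ μ)
    (hTcomm : ∀ x, T₁ (T₂ x) = T₂ (T₁ x))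
    -- the factor map `p`
    (p : Y → X) (hp : Measurable p) (hpν : Measure.map p ν = μ)
    (hp₁ : ∀ᵐ y ∂ν, p (S₁ y) = T₁ (p y)) (hp₂ : ∀ᵐ y ∂ν, p (S₂ y) = T₂ (p y))
    (hmagic : IsMagic μ T₁ T₂)
    (f : X → ℝ) (hf : Measurable f) (hfb : ∃ C : ℝ, ∀ x, |f x| ≤ C) :
    HasBoxAvg ν ⇑S₁ ⇑S₂
      (fun y => f (p y) - (ν[(fun y => f (p y)) | invSigma ⇑S₁ ⊔ invSigma ⇑S₂]) y)
      0 := by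
  obtain ⟨C, hC⟩ := hfb
  have hC₀ : 0 ≤ C := (abs_nonneg _).trans (hC (nonempty_of_isProbabilityMeasure μ).some)
  have hWX := invSigma_sup_le T₁ T₂
  have hWY := invSigma_sup_le S₁ S₂
  have hfi : Integrable f μ := .of_bound hf.aestronglyMeasurable C (Eventually.of_forall hC)
  -- a version of the conditional expectation bounded everywhere
  set k : X → ℝ := fun x => max (-C) (min ((μ[f | invSigma T₁ ⊔ invSigma T₂]) x) C) with hk
  have hkm : StronglyMeasurable[invSigma T₁ ⊔ invSigma T₂] k :=
    (measurable_const.max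
      (stronglyMeasurable_condExp.measurable.min measurable_const)).stronglyMeasurable
  have hkC : ∀ x, |k x| ≤ C := fun x =>
    abs_le.2 ⟨le_max_left _ _, max_le (by linarith) (min_le_right _ _)⟩
  have hkmeas : Measurable k := (hkm.mono hWX).measurable
  have hki : Integrable k μ := .of_bound hkmeas.aestronglyMeasurable C (Eventually.of_forall hkC)
  have hke : μ[f | invSigma T₁ ⊔ invSigma T₂] =ᵐ[μ] k := by
    have := ae_bdd_abs_condExp_of_ae_bdd_abs (m := invSigma T₁ ⊔ invSigma T₂)
      (Eventually.of_forall hC : ∀ᵐ x ∂μ, |f x| ≤ C)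
    filter_upwards [this] with x hx
    obtain ⟨h₁, h₂⟩ := abs_le.1 hx
    simp only [hk]
    rw [min_eq_left h₂, max_eq_right h₁]
  have hh : Measurable fun x => f x - k x := hf.sub hkmeas
  have hhC : ∀ x, |f x - k x| ≤ C + C := fun x =>
    (abs_sub _ _).trans (add_le_add (hC x) (hkC x))
  have hbox : HasBoxAvg μ T₁ T₂ (fun x => f x - k x) 0 := by
    refine hmagic _ hh ⟨_, hhC⟩ ?_
    have h₁ := condExp_sub hfi hki (invSigma T₁ ⊔ invSigma T₂)
    rw [condExp_of_stronglyMeasurable hWX hkm hki] at h₁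
    filter_upwards [h₁, hke] with x e₁ e₂
    change (μ[f - k | invSigma T₁ ⊔ invSigma T₂]) x = 0
    rw [e₁, Pi.sub_apply, e₂, sub_self]
  subst hpν
  have hboxY := hbox.comp_factor hS₁ hS₂ T₁.measurable T₂.measurable hp hp₁ hp₂ hh
  have hfp : Integrable (fun y => f (p y)) ν := hfi.comp_measurable hp
  have hkp : Integrable (fun y => k (p y)) ν := hki.comp_measurable hp
  have hzero : ν[fun y => f (p y) - k (p y) | invSigma S₁ ⊔ invSigma S₂] =ᵐ[ν] 0 :=
    condExp_sup_eq_zero_of_setIntegral_inter hWY (hfp.sub hkp) fun A B hA hB =>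
      hboxY.setIntegral_inter_eq_zero hS₁ hS₂ hScomm (hh.comp hp) (fun y => hhC (p y)) hA hB
  have hmap : invSigma T₁ ⊔ invSigma T₂ ≤
      (eventuallyMeasurableSpace (invSigma S₁ ⊔ invSigma S₂) (ae ν)).map p :=
    sup_le
      (fun s hs =>
        have ⟨t, ht, hte⟩ := invSigma_le_map_eventuallyMeasurableSpace hS₁ hp hp₁ s hs
        ⟨t, (le_sup_left : invSigma S₁ ≤ invSigma S₁ ⊔ invSigma S₂) t ht, hte⟩)
      (fun s hs =>
        have ⟨t, ht, hte⟩ := invSigma_le_map_eventuallyMeasurableSpace hS₂ hp hp₂ s hs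
        ⟨t, (le_sup_right : invSigma S₂ ≤ invSigma S₁ ⊔ invSigma S₂) t ht, hte⟩)
  have hkY : ν[fun y => k (p y) | invSigma S₁ ⊔ invSigma S₂] =ᵐ[ν] fun y => k (p y) :=
    condExp_of_aestronglyMeasurable' hWY (aestronglyMeasurable_comp_of_le_map_eventuallyMeasurableSpace hmap hkm) hkp
  refine hboxY.congr_ae hS₁ hS₂ ?_
  filter_upwards [hzero, hkY, condExp_sub hfp hkp (invSigma S₁ ⊔ invSigma S₂)] with y e₁ e₂ e₃
  change (ν[fun y => f (p y) - k (p y) | invSigma S₁ ⊔ invSigma S₂]) y = _ at e₃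
  rw [e₁, Pi.sub_apply, e₂, Pi.zero_apply] at e₃
  linarith
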